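/- arXiv:1503.05987 — 3 statements merged into one kernel-verified Lean document; each statement's English description precedes it below -/
import Mathlib

section
/- Let X_0 be a real random variable with density f, let x ≠ y be real numbers at which f is continuous, let K satisfy Condition C, and let b_n → 0 be a positive sequence. Then (1/b_n) · cov( K((x − X_0)/b_n), K((y − X_0)/b_n) ) → 0 as n → ∞. -/
open MeasureTheory ProbabilityTheory Filter

noncomputable section

/-- Condition C on the kernel `K`. -/
structure ConditionC (K : ℝ → ℝ) : Prop where
  symm : ∀ x, K (-x) = K x
  antitone : AntitoneOn K (Set.Ioi (0 : ℝ))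
  int_one : ∫ u, K u = 1
  decay : Tendsto (fun x => x ^ 2 * K x) atTop (nhds 0)
  diff : Differentiable ℝ K
  deriv_bdd : ∃ C, ∀ x, |deriv K x| ≤ C

/-- Covariance of two real random variables. -/
def covR {Ω : Type*} [MeasurableSpace Ω] (μ : Measure Ω) (Y Z : Ω → ℝ) : ℝ :=
  ∫ ω, Y ω * Z ω ∂μ - (∫ ω, Y ω ∂μ) * (∫ ω, Z ω ∂μ)

namespace ConditionC

variable {K : ℝ → ℝ}

lemma le_zero_of_pos (hK : ConditionC K) {u : ℝ} (hu : 0 < u) : K u ≤ K 0 := by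
  have hc : Tendsto K (nhdsWithin 0 (Set.Ioi 0)) (nhds (K 0)) :=
    hK.diff.continuous.continuousAt.tendsto.mono_left nhdsWithin_le_nhds
  refine ge_of_tendsto hc ?_
  filter_upwards [Ioo_mem_nhdsGT hu] with v hv
  exact hK.antitone hv.1 hu hv.2.le

lemma apply_abs (hK : ConditionC K) (u : ℝ) : K |u| = K u := by
  rcases abs_choice u with h | h <;> rw [h]
  exact hK.symm u

lemma le_of_abs_le (hK : ConditionC K) {u v : ℝ} (h : |v| ≤ |u|) : K u ≤ K v := by
  rw [← hK.apply_abs u, ← hK.apply_abs v]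
  rcases (abs_nonneg v).eq_or_lt with hv | hv
  · rw [← hv]
    rcases (abs_nonneg u).eq_or_lt with hu | hu
    · rw [← hu]
    · exact hK.le_zero_of_pos hu
  · exact hK.antitone hv (hv.trans_le h) h

lemma nonneg (hK : ConditionC K) (u : ℝ) : 0 ≤ K u := by
  by_contra! hneg
  have hlim : Tendsto (fun x : ℝ => x ^ 2 * K u) atTop atBot :=
    (tendsto_pow_atTop two_ne_zero).atTop_mul_const_of_neg hneg
  have hlim' : Tendsto (fun x => x ^ 2 * K x) atTop atBot := by
    refine tendsto_atBot_mono' atTop ?_ hlim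
    filter_upwards [eventually_ge_atTop |u|] with x hx
    exact mul_le_mul_of_nonneg_left (hK.le_of_abs_le (hx.trans (le_abs_self x))) (sq_nonneg x)
  exact not_tendsto_nhds_of_tendsto_atBot hlim' 0 hK.decay

lemma integrable (hK : ConditionC K) : Integrable K := by
  by_contra h
  have := hK.int_one
  rw [integral_undef h] at this
  exact zero_ne_one this

/-- The rescaled tail of the kernel is negligible with respect to the bandwidth. -/
lemma tendsto_tail (hK : ConditionC K) {δ : ℝ} (hδ : 0 < δ) {b : ℕ → ℝ}
    (hb_pos : ∀ n, 0 < b n) (hb0 : Tendsto b atTop (nhds 0)) :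
    Tendsto (fun n => K (δ / b n) / b n) atTop (nhds 0) := by
  have hinv : Tendsto (fun n => δ / b n) atTop atTop := by
    have hb : Tendsto b atTop (nhdsWithin 0 (Set.Ioi 0)) :=
      tendsto_nhdsWithin_iff.2 ⟨hb0, Eventually.of_forall hb_pos⟩
    simpa only [div_eq_mul_inv, Function.comp_def] using
      (tendsto_inv_nhdsGT_zero.comp hb).const_mul_atTop hδ
  have h := ((hK.decay.comp hinv).mul hb0).div_const (δ ^ 2)
  simp only [mul_zero, zero_div] at h
  refine h.congr fun n => ?_
  have := (hb_pos n).ne'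
  simp only [Function.comp_apply]
  field_simp

/-- A probability measure dominated by `M` times Lebesgue measure near `x` gives the rescaled
kernel at `x` a mean of order the bandwidth, up to the tail of the kernel. -/
lemma integral_rescaled_le (hK : ConditionC K) {ν : Measure ℝ} [IsProbabilityMeasure ν]
    {x δ M β : ℝ} (hδ : 0 < δ) (hM : 0 ≤ M) (hβ : 0 < β)
    (hν : ν.restrict (Metric.ball x δ) ≤ ENNReal.ofReal M • (volume : Measure ℝ)) :
    ∫ t, K ((x - t) / β) ∂ν ≤ M * β + K (δ / β) := by
  have hcont : Continuous fun t => K ((x - t) / β) := hK.diff.continuous.comp (by fun_prop)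
  have hint : Integrable (fun t => K ((x - t) / β)) ν := by
    refine Integrable.of_bound hcont.aestronglyMeasurable (K 0) (Eventually.of_forall fun t => ?_)
    rw [Real.norm_of_nonneg (hK.nonneg _)]
    exact hK.le_of_abs_le (by simp)
  have hint_vol : Integrable (fun t => K ((x - t) / β)) :=
    (hK.integrable.comp_div hβ.ne').comp_sub_left x
  have hnear : ∫ t in Metric.ball x δ, K ((x - t) / β) ∂ν ≤ M * β := by
    calc ∫ t in Metric.ball x δ, K ((x - t) / β) ∂ν
        ≤ ∫ t, K ((x - t) / β) ∂(ENNReal.ofReal M • (volume : Measure ℝ)) :=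
          integral_mono_measure hν (Eventually.of_forall fun t => hK.nonneg _)
            (hint_vol.smul_measure ENNReal.ofReal_ne_top)
      _ = M * β := by
          rw [integral_smul_measure, ENNReal.toReal_ofReal hM,
            integral_sub_left_eq_self (fun t => K (t / β)), Measure.integral_comp_div K β,
            hK.int_one, abs_of_pos hβ]
          simp
  have hsplit : ∀ t, K ((x - t) / β)
      ≤ (Metric.ball x δ).indicator (fun t => K ((x - t) / β)) t + K (δ / β) := by
    intro t
    by_cases ht : t ∈ Metric.ball x δ
    · rw [Set.indicator_of_mem ht]
      linarith [hK.nonneg (δ / β)]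
    · rw [Set.indicator_of_notMem ht, zero_add]
      refine hK.le_of_abs_le ?_
      rw [Metric.mem_ball, not_lt, dist_comm, Real.dist_eq] at ht
      rw [abs_div, abs_div, abs_of_pos hδ]
      gcongr
  calc ∫ t, K ((x - t) / β) ∂ν
      ≤ ∫ t, ((Metric.ball x δ).indicator (fun t => K ((x - t) / β)) t + K (δ / β)) ∂ν :=
        integral_mono hint ((hint.indicator measurableSet_ball).add (integrable_const _)) hsplit
    _ = ∫ t in Metric.ball x δ, K ((x - t) / β) ∂ν + K (δ / β) := by
        rw [integral_add (hint.indicator measurableSet_ball) (integrable_const _),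
          integral_indicator measurableSet_ball]
        simp
    _ ≤ M * β + K (δ / β) := by gcongr

/-- At points at distance at least `2 * δ`, one of the two rescaled kernels is in its tail. -/
lemma rescaled_mul_le (hK : ConditionC K) {x y δ β : ℝ} (hδ : 0 < δ) (hβ : 0 < β)
    (hxy : 2 * δ ≤ |x - y|) (t : ℝ) :
    K ((x - t) / β) * K ((y - t) / β) ≤ K 0 * K (δ / β) := by
  have hmax (u : ℝ) : K u ≤ K 0 := hK.le_of_abs_le (by simp)
  have htail {z : ℝ} (hz : δ ≤ |z - t|) : K ((z - t) / β) ≤ K (δ / β) := by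
    refine hK.le_of_abs_le ?_
    rw [abs_div, abs_div, abs_of_pos hδ]
    gcongr
  rcases le_or_gt δ |y - t| with h | h
  · exact mul_le_mul (hmax _) (htail h) (hK.nonneg _) (hK.nonneg _)
  · rw [mul_comm]
    refine mul_le_mul (hmax _) (htail ?_) (hK.nonneg _) (hK.nonneg _)
    have := abs_sub_le x t y
    rw [abs_sub_comm t y] at this
    linarith

end ConditionC

/-- Near a continuity point of `f`, the measure with density `f` is dominated by a multiple of the
base measure. -/
lemma exists_restrict_withDensity_le {f : ℝ → ℝ} {x : ℝ} (hfx : ContinuousAt f x) :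
    ∃ ε > 0, ∀ δ ≤ ε,
      ((volume : Measure ℝ).withDensity fun t => ENNReal.ofReal (f t)).restrict (Metric.ball x δ)
        ≤ ENNReal.ofReal (|f x| + 1) • (volume : Measure ℝ) := by
  have hlt : ∀ᶠ t in nhds x, f t < |f x| + 1 :=
    hfx.eventually_lt_const (by linarith [le_abs_self (f x)])
  obtain ⟨ε, hε, hball⟩ := Metric.eventually_nhds_iff_ball.1 hlt
  refine ⟨ε, hε, fun δ hδ => ?_⟩
  rw [restrict_withDensity measurableSet_ball]
  calc ((volume : Measure ℝ).restrict (Metric.ball x δ)).withDensity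
        (fun t => ENNReal.ofReal (f t))
      ≤ ((volume : Measure ℝ).restrict (Metric.ball x δ)).withDensity
        (fun _ => ENNReal.ofReal (|f x| + 1)) := by
        refine withDensity_mono ?_
        filter_upwards [ae_restrict_mem measurableSet_ball] with t ht
        exact ENNReal.ofReal_le_ofReal (hball t (Metric.ball_subset_ball hδ ht)).le
    _ = ENNReal.ofReal (|f x| + 1) • (volume : Measure ℝ).restrict (Metric.ball x δ) :=
        withDensity_const _
    _ ≤ ENNReal.ofReal (|f x| + 1) • (volume : Measure ℝ) := by
        gcongr
        exact Measure.restrict_le_self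

/-- The cross-covariance term `(1/b_n) cov(K((x - X_0)/b_n), K((y - X_0)/b_n))` vanishes
asymptotically at distinct continuity points of the density. -/
theorem cross_cov_tendsto_zero {Ω : Type*} [MeasurableSpace Ω]
    (μ : Measure Ω) [IsProbabilityMeasure μ]
    (X₀ : Ω → ℝ) (hX₀ : Measurable X₀)
    (f : ℝ → ℝ) (hf_nonneg : ∀ x, 0 ≤ f x)
    (hdens : μ.map X₀ = (volume : Measure ℝ).withDensity (fun x => ENNReal.ofReal (f x)))
    (x y : ℝ) (hxy : x ≠ y) (hfx : ContinuousAt f x) (hfy : ContinuousAt f y)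
    (K : ℝ → ℝ) (hK : ConditionC K)
    (b : ℕ → ℝ) (hb_pos : ∀ n, 0 < b n) (hb0 : Tendsto b atTop (nhds 0)) :
    Tendsto (fun n : ℕ => (1 / b n)
        * covR μ (fun ω => K ((x - X₀ ω) / b n)) (fun ω => K ((y - X₀ ω) / b n)))
      atTop (nhds 0) := by
  obtain ⟨ε₁, hε₁, h₁⟩ := exists_restrict_withDensity_le hfx
  obtain ⟨ε₂, hε₂, h₂⟩ := exists_restrict_withDensity_le hfy
  rw [← hdens] at h₁ h₂
  have hd : 0 < |x - y| := abs_pos.2 (sub_ne_zero.2 hxy)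
  obtain ⟨δ, hδ, hδ_le⟩ : ∃ δ > 0, δ ≤ ε₁ ∧ δ ≤ ε₂ ∧ 2 * δ ≤ |x - y| :=
    ⟨min (min ε₁ ε₂) (|x - y| / 2), by positivity,
      (min_le_left _ _).trans (min_le_left _ _), (min_le_left _ _).trans (min_le_right _ _), by
        linarith [min_le_right (min ε₁ ε₂) (|x - y| / 2)]⟩
  have : IsProbabilityMeasure (μ.map X₀) := Measure.isProbabilityMeasure_map hX₀.aemeasurable
  have hmap (g : ℝ → ℝ) (hg : Continuous g) : ∫ ω, g (X₀ ω) ∂μ = ∫ t, g t ∂(μ.map X₀) :=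
    (integral_map hX₀.aemeasurable hg.aestronglyMeasurable).symm
  have hcont (z β : ℝ) : Continuous fun t => K ((z - t) / β) :=
    hK.diff.continuous.comp (by fun_prop)
  set κ : ℕ → ℝ := fun n => K (δ / b n)
  set M := |f x| + 1
  set N := |f y| + 1
  have hM : 0 ≤ M := by positivity
  have hN : 0 ≤ N := by positivity
  have htail : Tendsto (fun n => κ n / b n) atTop (nhds 0) := hK.tendsto_tail hδ hb_pos hb0
  have hbound : Tendsto (fun n => K 0 * (κ n / b n)
      + b n * ((M + κ n / b n) * (N + κ n / b n))) atTop (nhds 0) := by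
    simpa using (htail.const_mul (K 0)).add
      (hb0.mul ((htail.const_add M).mul (htail.const_add N)))
  refine squeeze_zero_norm (fun n => ?_) hbound
  have hb := hb_pos n
  have hEx : ∫ ω, K ((x - X₀ ω) / b n) ∂μ ≤ M * b n + κ n := by
    rw [hmap _ (hcont x (b n))]
    exact hK.integral_rescaled_le hδ hM hb (h₁ δ hδ_le.1)
  have hEy : ∫ ω, K ((y - X₀ ω) / b n) ∂μ ≤ N * b n + κ n := by
    rw [hmap _ (hcont y (b n))]
    exact hK.integral_rescaled_le hδ hN hb (h₂ δ hδ_le.2.1)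
  have hEx0 : 0 ≤ ∫ ω, K ((x - X₀ ω) / b n) ∂μ := integral_nonneg fun _ => hK.nonneg _
  have hEy0 : 0 ≤ ∫ ω, K ((y - X₀ ω) / b n) ∂μ := integral_nonneg fun _ => hK.nonneg _
  have hExy0 : 0 ≤ ∫ ω, K ((x - X₀ ω) / b n) * K ((y - X₀ ω) / b n) ∂μ :=
    integral_nonneg fun _ => mul_nonneg (hK.nonneg _) (hK.nonneg _)
  have hExy : ∫ ω, K ((x - X₀ ω) / b n) * K ((y - X₀ ω) / b n) ∂μ ≤ K 0 * κ n := by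
    refine (integral_mono_of_nonneg
      (Eventually.of_forall fun _ => mul_nonneg (hK.nonneg _) (hK.nonneg _))
      (integrable_const (K 0 * κ n))
      (Eventually.of_forall fun ω => hK.rescaled_mul_le hδ hb hδ_le.2.2 (X₀ ω))).trans_eq ?_
    simp
  have hprod := mul_le_mul hEx hEy hEy0 (hEx0.trans hEx)
  have hprod0 := mul_nonneg hEx0 hEy0
  have hcov : |covR μ (fun ω => K ((x - X₀ ω) / b n)) (fun ω => K ((y - X₀ ω) / b n))|
      ≤ K 0 * κ n + (M * b n + κ n) * (N * b n + κ n) := by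
    rw [covR, abs_le]
    constructor <;> linarith
  rw [Real.norm_eq_abs, abs_mul, abs_of_pos (one_div_pos.2 hb)]
  calc 1 / b n * |covR μ (fun ω => K ((x - X₀ ω) / b n)) (fun ω => K ((y - X₀ ω) / b n))|
      ≤ 1 / b n * (K 0 * κ n + (M * b n + κ n) * (N * b n + κ n)) := by gcongr
    _ = K 0 * (κ n / b n) + b n * ((M + κ n / b n) * (N + κ n / b n)) := by
        field_simp
end
end

section
/- Let X_0 be a real random variable with density f, let x_1,…,x_m be distinct real numbers at which f is continuous and nonzero, let K satisfy Condition C, let b_n → 0, and let λ_1,…,λ_m be real numbers. Define Y_n = b_n^{-1/2} ∑_{j=1}^m ( λ_j / (f(x_j) ∫ K²(u)du)^{1/2} ) ( K((x_j − X_0)/b_n) − E K((x_j − X_0)/b_n) ). Then var(Y_n) → ∑_{j=1}^m λ_j² as n → ∞. -/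
open MeasureTheory ProbabilityTheory Filter

noncomputable section

/-- A density with respect to `μ` that is continuous at a point, but possibly not measurable, can be
replaced by an almost everywhere measurable one that has the same limit at that point. -/
lemma exists_aemeasurable_withDensity_eq_of_continuousAt {α : Type*} [TopologicalSpace α]
    [MeasurableSpace α] [BorelSpace α] {μ : Measure α} [SigmaFinite μ] {F : α → ENNReal} {x : α}
    (hF : ContinuousAt F x) :
    ∃ g : α → ENNReal, AEMeasurable g μ ∧ μ.withDensity g = μ.withDensity F ∧
      Tendsto g (nhds x) (nhds (F x)) := by
  obtain ⟨g, hgm, hgF, hg⟩ := exists_measurable_le_withDensity_eq μ F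
  let v : ℚ → ENNReal := fun q => (Real.toNNReal q : ENNReal)
  have hae : ∀ᵐ y ∂μ, ∀ q : ℚ, y ∈ interior {z | v q < F z} → v q ≤ g y := by
    refine ae_all_iff.2 fun q => ?_
    have hU : MeasurableSet (interior {z | v q < F z}) := isOpen_interior.measurableSet
    have hle : (interior {z | v q < F z}).indicator (fun _ => v q) ≤ᵐ[μ] g := by
      refine ae_le_of_forall_setLIntegral_le_of_sigmaFinite (measurable_const.indicator hU)
        fun s hs _ => ?_
      rw [← withDensity_apply g hs, hg, withDensity_apply F hs]
      refine lintegral_mono fun y => Set.indicator_le (fun z hz => ?_) y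
      have hlt : v q < F z := by simpa using interior_subset hz
      exact hlt.le
    filter_upwards [hle] with y hy hyU
    simpa [Set.indicator_of_mem hyU] using hy
  classical
  let h : α → ENNReal := fun y =>
    if ∀ q : ℚ, y ∈ interior {z | v q < F z} → v q ≤ g y then g y else F x
  have hgh : g =ᵐ[μ] h := by
    filter_upwards [hae] with y hy
    simp only [h, if_pos hy]
  refine ⟨h, hgm.aemeasurable.congr hgh, (withDensity_congr_ae hgh).symm.trans hg,
    tendsto_order.2 ⟨fun a ha => ?_, fun a ha => ?_⟩⟩
  · obtain ⟨q, -, haq, hqF⟩ := ENNReal.lt_iff_exists_rat_btwn.1 ha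
    have hmem : interior {z | v q < F z} ∈ nhds x :=
      interior_mem_nhds.2 (hF.eventually (lt_mem_nhds hqF))
    filter_upwards [hmem] with y hy
    by_cases hG : ∀ q : ℚ, y ∈ interior {z | v q < F z} → v q ≤ g y
    · simp only [h, if_pos hG]
      exact haq.trans_le (hG q hy)
    · simpa only [h, if_neg hG] using ha
  · filter_upwards [hF.eventually (gt_mem_nhds ha)] with y hy
    by_cases hG : ∀ q : ℚ, y ∈ interior {z | v q < F z} → v q ≤ g y
    · simp only [h, if_pos hG]
      exact (hgF y).trans_lt hy
    · simpa only [h, if_neg hG] using ha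

/-- Bochner's lemma for a finite measure whose density is continuous at `x`. -/
lemma tendsto_integral_scaled_kernel {ν : Measure ℝ} [IsFiniteMeasure ν] {F : ℝ → ENNReal}
    (hν : ν = volume.withDensity F) {x : ℝ} (hF : ContinuousAt F x) (hFx : F x ≠ ⊤)
    {φ : ℝ → ℝ} (hφ : ∀ u, 0 ≤ φ u) (hφpos : 0 < ∫ u, φ u)
    (hφdecay : Tendsto (fun u => ‖u‖ * φ u) (Bornology.cobounded ℝ) (nhds 0)) :
    Tendsto (fun c : ℝ => c * ∫ y, φ (c * (x - y)) ∂ν) atTop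
      (nhds ((F x).toReal * ∫ u, φ u)) := by
  obtain ⟨g, hgm, hg, hgx⟩ := exists_aemeasurable_withDensity_eq_of_continuousAt (μ := volume) hF
  have hx : g x = F x := eq_of_tendsto_nhds hgx
  have hfin : ∫⁻ y, g y ≠ ⊤ := by
    rw [← setLIntegral_univ, ← withDensity_apply g MeasurableSet.univ, hg, ← hν]
    exact measure_ne_top ν _
  have hcont : ContinuousAt (fun y => (g y).toReal) x := by
    change Tendsto _ _ (nhds (g x).toReal)
    rw [hx]
    exact (ENNReal.tendsto_toReal hFx).comp hgx
  have hdecay : Tendsto (fun u => ‖u‖ ^ Module.finrank ℝ ℝ * (φ u / ∫ u, φ u))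
      (Bornology.cobounded ℝ) (nhds 0) := by
    simpa [mul_div_assoc] using hφdecay.div_const (∫ u, φ u)
  have key := (tendsto_integral_comp_smul_smul_of_integrable' (μ := volume)
    (fun u => div_nonneg (hφ u) hφpos.le) (by rw [integral_div, div_self hφpos.ne']) hdecay
    (integrable_toReal_of_lintegral_ne_top hgm hfin) hcont).mul_const (∫ u, φ u)
  rw [hx] at key
  refine key.congr fun c => ?_
  rw [hν, ← hg, integral_withDensity_eq_integral_toReal_smul₀ hgm (ae_lt_top' hgm hfin),
    ← integral_const_mul c, ← integral_mul_const (∫ u, φ u)]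
  congr 1 with y
  simp only [Module.finrank_self, pow_one, smul_eq_mul]
  field_simp

namespace ConditionC

variable {K : ℝ → ℝ}

lemma continuous (hK : ConditionC K) : Continuous K := hK.diff.continuous

lemma apply_norm (hK : ConditionC K) (u : ℝ) : K ‖u‖ = K u := by
  rcases abs_choice u with h | h <;> simp [Real.norm_eq_abs, h, hK.symm]

lemma antitone_norm (hK : ConditionC K) {d u : ℝ} (hd : 0 < d) (hu : d ≤ |u|) : K u ≤ K d := by
  rw [← hK.apply_norm u]
  exact hK.antitone hd (hd.trans_le hu) hu

lemma le_zero (hK : ConditionC K) (u : ℝ) : K u ≤ K 0 := by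
  rcases eq_or_ne u 0 with rfl | hu
  · exact le_rfl
  refine ge_of_tendsto (hK.continuous.continuousAt.tendsto.mono_left
    (nhdsWithin_le_nhds (s := Set.Ioi (0 : ℝ)))) ?_
  filter_upwards [self_mem_nhdsWithin,
    nhdsWithin_le_nhds (gt_mem_nhds (abs_pos.2 hu))] with z hz hzu
  exact hK.antitone_norm hz hzu.le

lemma tendsto_atTop_zero (hK : ConditionC K) : Tendsto K atTop (nhds 0) := by
  refine squeeze_zero' (Eventually.of_forall hK.nonneg) ?_ hK.decay
  filter_upwards [eventually_ge_atTop 1] with u hu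
  exact le_mul_of_one_le_left (hK.nonneg u) (one_le_pow₀ hu)

lemma tendsto_norm_mul (hK : ConditionC K) :
    Tendsto (fun u => ‖u‖ * K u) (Bornology.cobounded ℝ) (nhds 0) := by
  refine squeeze_zero' (Eventually.of_forall fun u => mul_nonneg (norm_nonneg u) (hK.nonneg u)) ?_
    (hK.decay.comp tendsto_norm_cobounded_atTop)
  filter_upwards [tendsto_norm_cobounded_atTop.eventually_ge_atTop 1] with u hu
  simp only [Function.comp_apply, hK.apply_norm]
  exact mul_le_mul_of_nonneg_right (le_self_pow₀ hu two_ne_zero) (hK.nonneg u)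

lemma tendsto_norm_mul_sq (hK : ConditionC K) :
    Tendsto (fun u => ‖u‖ * K u ^ 2) (Bornology.cobounded ℝ) (nhds 0) := by
  refine squeeze_zero (fun u => by positivity) (fun u => ?_)
    (by simpa using hK.tendsto_norm_mul.mul_const (K 0))
  rw [sq, ← mul_assoc]
  exact mul_le_mul_of_nonneg_left (hK.le_zero u) (mul_nonneg (norm_nonneg u) (hK.nonneg u))

lemma integral_sq_pos (hK : ConditionC K) : 0 < ∫ u, K u ^ 2 := by
  have hint : Integrable fun u => K u ^ 2 := by
    refine (hK.integrable.const_mul (K 0)).mono'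
      (hK.continuous.pow 2).aestronglyMeasurable (Eventually.of_forall fun u => ?_)
    rw [Real.norm_of_nonneg (sq_nonneg _), sq]
    exact mul_le_mul_of_nonneg_right (hK.le_zero u) (hK.nonneg u)
  refine (integral_nonneg fun u => sq_nonneg (K u)).lt_of_ne' fun h => ?_
  have hzero := (integral_eq_zero_iff_of_nonneg (fun u => sq_nonneg (K u)) hint).1 h
  have : ∫ u, K u = 0 := by
    refine integral_eq_zero_of_ae ?_
    filter_upwards [hzero] with u hu
    exact pow_eq_zero_iff two_ne_zero |>.1 hu
  exact one_ne_zero (hK.int_one.symm.trans this)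

variable {ν : Measure ℝ} [IsFiniteMeasure ν]

lemma memLp_comp (hK : ConditionC K) {c x : ℝ} : MemLp (fun y => K (c * (x - y))) 2 ν := by
  refine MemLp.of_bound (hK.continuous.comp (by fun_prop)).aestronglyMeasurable (K 0)
    (Eventually.of_forall fun y => ?_)
  rw [Real.norm_of_nonneg (hK.nonneg _)]
  exact hK.le_zero _

lemma integrable_comp (hK : ConditionC K) {c x : ℝ} :
    Integrable (fun y => K (c * (x - y))) ν :=
  hK.memLp_comp.integrable one_le_two

/-- Kernels centred at two distinct points are asymptotically orthogonal. -/
lemma tendsto_integral_mul_of_ne (hK : ConditionC K) {x x' l l' : ℝ} (hne : x ≠ x')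
    (hx : Tendsto (fun c : ℝ => c * ∫ y, K (c * (x - y)) ∂ν) atTop (nhds l))
    (hx' : Tendsto (fun c : ℝ => c * ∫ y, K (c * (x' - y)) ∂ν) atTop (nhds l')) :
    Tendsto (fun c : ℝ => c * ∫ y, K (c * (x - y)) * K (c * (x' - y)) ∂ν) atTop (nhds 0) := by
  have hd : 0 < |x - x'| / 2 := half_pos (abs_pos.2 (sub_ne_zero.2 hne))
  have hlim : Tendsto (fun c : ℝ => K (c * (|x - x'| / 2)) *
      (c * ∫ y, K (c * (x - y)) ∂ν + c * ∫ y, K (c * (x' - y)) ∂ν)) atTop (nhds 0) := by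
    simpa using (hK.tendsto_atTop_zero.comp (tendsto_id.atTop_mul_const hd)).mul (hx.add hx')
  refine squeeze_zero' ?_ ?_ hlim
  · filter_upwards [eventually_ge_atTop 0] with c hc
    exact mul_nonneg hc (integral_nonneg fun y => mul_nonneg (hK.nonneg _) (hK.nonneg _))
  · filter_upwards [eventually_gt_atTop 0] with c hc
    rw [← mul_add, ← integral_add hK.integrable_comp hK.integrable_comp, mul_left_comm,
      ← integral_const_mul (K _)]
    refine mul_le_mul_of_nonneg_left (integral_mono
      ((hK.memLp_comp (ν := ν)).integrable_mul hK.memLp_comp)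
      ((hK.integrable_comp.add hK.integrable_comp).const_mul _) fun y => ?_) hc.le
    have hfar : ∀ z, |x - x'| / 2 ≤ |z| → K (c * z) ≤ K (c * (|x - x'| / 2)) := by
      intro z hz
      refine hK.antitone_norm (mul_pos hc hd) ?_
      rw [abs_mul, abs_of_pos hc]
      exact mul_le_mul_of_nonneg_left hz hc.le
    have h1 := hK.nonneg (c * (x - y))
    have h2 := hK.nonneg (c * (x' - y))
    have h3 := hK.nonneg (c * (|x - x'| / 2))
    have htri : |x - x'| ≤ |x - y| + |x' - y| := by
      rw [abs_sub_comm x' y]; exact abs_sub_le x y x'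
    beta_reduce
    rcases le_total (|x - x'| / 2) |x - y| with h | h
    · nlinarith [hfar _ h, mul_nonneg h3 h1]
    · nlinarith [hfar (x' - y) (by linarith), mul_nonneg h3 h2]

end ConditionC

/-- `covR` is the covariance of square-integrable random variables. -/
lemma covR_eq_covariance {Ω : Type*} [MeasurableSpace Ω] {μ : Measure Ω} [IsProbabilityMeasure μ]
    {Y Z : Ω → ℝ} (hY : MemLp Y 2 μ) (hZ : MemLp Z 2 μ) : covR μ Y Z = cov[Y, Z; μ] := by
  rw [covariance_eq_sub hY hZ]
  rfl

/-- The variance of a normalized, centred linear combination as a double sum. -/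
lemma covR_normalized_sum {Ω : Type*} [MeasurableSpace Ω] {μ : Measure Ω}
    [IsProbabilityMeasure μ] {ι : Type*} [Fintype ι] {V : ι → Ω → ℝ}
    (hV : ∀ i, MemLp (V i) 2 μ) (a : ι → ℝ) {s : ℝ} (hs : 0 ≤ s) :
    covR μ (fun ω => (1 / √s) * ∑ i, a i * (V i ω - ∫ ω', V i ω' ∂μ))
        (fun ω => (1 / √s) * ∑ i, a i * (V i ω - ∫ ω', V i ω' ∂μ)) =
      ∑ i, ∑ j, a i * (a j * (s⁻¹ * (∫ ω, V i ω * V j ω ∂μ) -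
        s * ((s⁻¹ * ∫ ω, V i ω ∂μ) * (s⁻¹ * ∫ ω, V j ω ∂μ)))) := by
  have hW : ∀ i, MemLp (fun ω => a i * (V i ω - ∫ ω', V i ω' ∂μ)) 2 μ := fun i =>
    ((hV i).sub (memLp_const _)).const_mul _
  have hS := (memLp_finsetSum Finset.univ fun i _ => hW i).const_mul (1 / √s)
  rw [covR_eq_covariance hS hS, covariance_const_mul_left, covariance_const_mul_right,
    covariance_fun_sum_fun_sum hW hW, Finset.mul_sum, Finset.mul_sum]
  refine Finset.sum_congr rfl fun i _ => ?_
  rw [Finset.mul_sum, Finset.mul_sum]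
  refine Finset.sum_congr rfl fun j _ => ?_
  rw [covariance_const_mul_left, covariance_const_mul_right,
    covariance_sub_const_left ((hV i).integrable one_le_two),
    covariance_sub_const_right ((hV j).integrable one_le_two), covariance_eq_sub (hV i) (hV j)]
  simp only [Pi.mul_apply]
  rcases hs.eq_or_lt with rfl | hs
  · simp
  · have hsq : √s ^ 2 = s := Real.sq_sqrt hs.le
    have hs' : √s ≠ 0 := (Real.sqrt_pos.2 hs).ne'
    field_simp
    rw [hsq]
    field_simp

/-- The variance of the normalized kernel statistic converges to `∑ λ_j²`. -/
theorem var_kernel_statistic_tendsto {Ω : Type*} [MeasurableSpace Ω]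
    (μ : Measure Ω) [IsProbabilityMeasure μ]
    (X₀ : Ω → ℝ) (hX₀ : Measurable X₀)
    (f : ℝ → ℝ) (hf_nonneg : ∀ x, 0 ≤ f x)
    (hdens : μ.map X₀ = (volume : Measure ℝ).withDensity (fun x => ENNReal.ofReal (f x)))
    (m : ℕ) (x : Fin m → ℝ) (hx_distinct : Function.Injective x)
    (hf_cont : ∀ j, ContinuousAt f (x j)) (hf_ne : ∀ j, f (x j) ≠ 0)
    (K : ℝ → ℝ) (hK : ConditionC K)
    (b : ℕ → ℝ) (hb_pos : ∀ n, 0 < b n) (hb0 : Tendsto b atTop (nhds 0))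
    (lam : Fin m → ℝ)
    (Y : ℕ → Ω → ℝ)
    (hY : ∀ n ω, Y n ω = (1 / Real.sqrt (b n)) * ∑ j : Fin m,
        (lam j / Real.sqrt (f (x j) * ∫ u : ℝ, K u ^ 2))
          * (K ((x j - X₀ ω) / b n) - ∫ ω', K ((x j - X₀ ω') / b n) ∂μ)) :
    Tendsto (fun n : ℕ => covR μ (Y n) (Y n)) atTop (nhds (∑ j : Fin m, lam j ^ 2)) := by
  set ν := μ.map X₀ with hν
  have : IsProbabilityMeasure ν := Measure.isProbabilityMeasure_map hX₀.aemeasurable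
  have hF : ∀ j, ContinuousAt (fun y => ENNReal.ofReal (f y)) (x j) := fun j =>
    ENNReal.continuous_ofReal.continuousAt.comp (hf_cont j)
  have htoReal : ∀ j, (ENNReal.ofReal (f (x j))).toReal = f (x j) := fun j =>
    ENNReal.toReal_ofReal (hf_nonneg _)
  have hκ := hK.integral_sq_pos
  have hmean : ∀ j, Tendsto (fun c : ℝ => c * ∫ y, K (c * (x j - y)) ∂ν) atTop
      (nhds (f (x j))) := fun j => by
    have := tendsto_integral_scaled_kernel hdens (hF j) ENNReal.ofReal_ne_top hK.nonneg
      (by rw [hK.int_one]; exact one_pos) hK.tendsto_norm_mul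
    rwa [hK.int_one, mul_one, htoReal] at this
  have hprod : ∀ i j, Tendsto
      (fun c : ℝ => c * ∫ y, K (c * (x i - y)) * K (c * (x j - y)) ∂ν) atTop
      (nhds (if i = j then f (x i) * ∫ u, K u ^ 2 else 0)) := fun i j => by
    split_ifs with hij
    · subst hij
      have := tendsto_integral_scaled_kernel hdens (hF i) ENNReal.ofReal_ne_top
        (fun u => sq_nonneg (K u)) hκ hK.tendsto_norm_mul_sq
      simpa only [htoReal, sq] using this
    · exact hK.tendsto_integral_mul_of_ne (hx_distinct.ne hij) (hmean i) (hmean j)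
  have hb : Tendsto (fun n => (b n)⁻¹) atTop atTop :=
    (tendsto_nhdsWithin_iff.2 ⟨hb0, Eventually.of_forall hb_pos⟩).inv_tendsto_nhdsGT_zero
  let a : Fin m → ℝ := fun j => lam j / √(f (x j) * ∫ u : ℝ, K u ^ 2)
  have hcov : ∀ n, covR μ (Y n) (Y n) = ∑ i, ∑ j, a i * (a j *
      ((b n)⁻¹ * (∫ y, K ((b n)⁻¹ * (x i - y)) * K ((b n)⁻¹ * (x j - y)) ∂ν) -
        b n * (((b n)⁻¹ * ∫ y, K ((b n)⁻¹ * (x i - y)) ∂ν) *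
          ((b n)⁻¹ * ∫ y, K ((b n)⁻¹ * (x j - y)) ∂ν)))) := by
    intro n
    have hmap : ∀ {h : ℝ → ℝ}, Continuous h → ∫ y, h y ∂ν = ∫ ω, h (X₀ ω) ∂μ := fun hh =>
      integral_map hX₀.aemeasurable hh.aestronglyMeasurable
    have hKc := hK.continuous
    have hV : ∀ j, MemLp (fun ω => K ((b n)⁻¹ * (x j - X₀ ω))) 2 μ := fun j =>
      (hK.memLp_comp (ν := ν)).comp_of_map hX₀.aemeasurable
    have hYn : Y n = fun ω => (1 / √(b n)) * ∑ i, a i *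
        (K ((b n)⁻¹ * (x i - X₀ ω)) - ∫ ω', K ((b n)⁻¹ * (x i - X₀ ω')) ∂μ) := by
      ext ω
      simp only [hY, a, div_eq_inv_mul (_ - _) (b n)]
    rw [hYn, covR_normalized_sum hV a (hb_pos n).le]
    refine Finset.sum_congr rfl fun i _ => Finset.sum_congr rfl fun j _ => ?_
    rw [hmap (by fun_prop), hmap (by fun_prop), hmap (by fun_prop)]
  simp_rw [hcov]
  have hterm : ∀ i j, Tendsto (fun n => a i * (a j *
      ((b n)⁻¹ * (∫ y, K ((b n)⁻¹ * (x i - y)) * K ((b n)⁻¹ * (x j - y)) ∂ν) -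
        b n * (((b n)⁻¹ * ∫ y, K ((b n)⁻¹ * (x i - y)) ∂ν) *
          ((b n)⁻¹ * ∫ y, K ((b n)⁻¹ * (x j - y)) ∂ν))))) atTop
      (nhds (a i * (a j * ((if i = j then f (x i) * ∫ u, K u ^ 2 else 0) -
        0 * (f (x i) * f (x j)))))) := fun i j =>
    ((((hprod i j).comp hb).sub
      (hb0.mul (((hmean i).comp hb).mul ((hmean j).comp hb)))).const_mul _).const_mul _
  convert tendsto_finsetSum Finset.univ fun i _ => tendsto_finsetSum Finset.univ fun j _ =>
    hterm i j using 2
  refine Finset.sum_congr rfl fun i _ => ?_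
  have hpos : 0 < f (x i) * ∫ u, K u ^ 2 :=
    mul_pos ((hf_nonneg _).lt_of_ne' (hf_ne i)) hκ
  simp only [zero_mul, sub_zero, mul_ite, mul_zero, Finset.sum_ite_eq, Finset.mem_univ, if_true]
  rw [← mul_assoc, ← sq, div_pow, Real.sq_sqrt hpos.le, div_mul_cancel₀ _ hpos.ne']
end
end

section
/- Let (X_0, X_k) be a pair of square-integrable real random variables such that H_k(x,y) ≥ 0 for all (x,y) ∈ ℝ². Then η_k = cov(X_0, X_k). -/
open MeasureTheory ProbabilityTheory Filter

noncomputable section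

/-- `H(u,v) = P(X_0 > u, X_k > v) - P(X_0 > u) P(X_k > v)` for a pair `(X_0, X_k)`. -/
def Hpair {Ω : Type*} [MeasurableSpace Ω] (μ : Measure Ω) (X₀ Xk : Ω → ℝ) (u v : ℝ) : ℝ :=
  (μ {ω | u < X₀ ω ∧ v < Xk ω}).toReal
    - (μ {ω | u < X₀ ω}).toReal * (μ {ω | v < Xk ω}).toReal

/-- `η = ∫∫ |H(u,v)| du dv`. -/
def etaPair {Ω : Type*} [MeasurableSpace Ω] (μ : Measure Ω) (X₀ Xk : Ω → ℝ) : ℝ :=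
  ∫ u : ℝ, ∫ v : ℝ, |Hpair μ X₀ Xk u v|

/-- The signed indicator `1_{u < x} - 1_{u < 0}`, whose integral in `u` is `x`. -/
def signedIndicator (x u : ℝ) : ℝ :=
  (if u < x then 1 else 0) - (if u < 0 then 1 else 0)

lemma signedIndicator_eq_indicator_sub (x : ℝ) :
    signedIndicator x =
      fun u => (Set.Ico 0 x).indicator (fun _ => (1 : ℝ)) u
        - (Set.Ico x 0).indicator (fun _ => (1 : ℝ)) u := by
  funext u
  simp only [signedIndicator, Set.indicator_apply, Set.mem_Ico]
  grind

lemma norm_signedIndicator_eq_indicator_add (x : ℝ) :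
    (fun u => ‖signedIndicator x u‖) =
      fun u => (Set.Ico 0 x).indicator (fun _ => (1 : ℝ)) u
        + (Set.Ico x 0).indicator (fun _ => (1 : ℝ)) u := by
  funext u
  simp only [signedIndicator, Set.indicator_apply, Set.mem_Ico, Real.norm_eq_abs]
  grind

lemma integrable_indicator_Ico_one (a b : ℝ) :
    Integrable ((Set.Ico a b).indicator (fun _ => (1 : ℝ))) :=
  (integrable_indicator_iff measurableSet_Ico).2 (integrableOn_const (by simp) (by simp))

lemma integral_indicator_Ico_one (a b : ℝ) :
    ∫ u, (Set.Ico a b).indicator (fun _ => (1 : ℝ)) u = max (b - a) 0 := by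
  rw [integral_indicator measurableSet_Ico]
  simp [Measure.real, ENNReal.toReal_ofReal']

lemma integrable_signedIndicator (x : ℝ) : Integrable (signedIndicator x) := by
  rw [signedIndicator_eq_indicator_sub]
  exact (integrable_indicator_Ico_one _ _).sub (integrable_indicator_Ico_one _ _)

lemma integral_signedIndicator (x : ℝ) : ∫ u, signedIndicator x u = x := by
  rw [signedIndicator_eq_indicator_sub,
    integral_sub (integrable_indicator_Ico_one _ _) (integrable_indicator_Ico_one _ _),
    integral_indicator_Ico_one, integral_indicator_Ico_one]
  grind

lemma integral_norm_signedIndicator (x : ℝ) : ∫ u, ‖signedIndicator x u‖ = |x| := by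
  rw [norm_signedIndicator_eq_indicator_add,
    integral_add (integrable_indicator_Ico_one _ _) (integrable_indicator_Ico_one _ _),
    integral_indicator_Ico_one, integral_indicator_Ico_one]
  grind

lemma measurable_signedIndicator_uncurry :
    Measurable (fun p : ℝ × ℝ => signedIndicator p.1 p.2) := by
  unfold signedIndicator
  exact (Measurable.ite (measurableSet_lt measurable_snd measurable_fst)
    measurable_const measurable_const).sub
    (Measurable.ite (measurableSet_lt measurable_snd measurable_const)
    measurable_const measurable_const)

section

variable {Ω : Type*} [MeasurableSpace Ω] {μ : Measure Ω} {X Y : Ω → ℝ}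

lemma integrable_signedIndicator_prod [SFinite μ] (hX : Measurable X) (hXi : Integrable X μ) :
    Integrable (fun p : Ω × ℝ => signedIndicator (X p.1) p.2) (μ.prod volume) := by
  have hm : Measurable (fun p : Ω × ℝ => signedIndicator (X p.1) p.2) :=
    measurable_signedIndicator_uncurry.comp ((hX.comp measurable_fst).prodMk measurable_snd)
  rw [integrable_prod_iff hm.aestronglyMeasurable]
  refine ⟨ae_of_all _ fun ω => integrable_signedIndicator (X ω), ?_⟩
  simpa only [integral_norm_signedIndicator] using hXi.abs

lemma integrable_signedIndicator_mul_prod [SFinite μ] (hX : Measurable X) (hY : Measurable Y)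
    (hXY : Integrable (fun ω => X ω * Y ω) μ) :
    Integrable (fun p : Ω × (ℝ × ℝ) =>
      signedIndicator (X p.1) p.2.1 * signedIndicator (Y p.1) p.2.2)
      (μ.prod (volume.prod volume)) := by
  have hm : Measurable (fun p : Ω × (ℝ × ℝ) =>
      signedIndicator (X p.1) p.2.1 * signedIndicator (Y p.1) p.2.2) :=
    (measurable_signedIndicator_uncurry.comp
      ((hX.comp measurable_fst).prodMk measurable_snd.fst)).mul
    (measurable_signedIndicator_uncurry.comp
      ((hY.comp measurable_fst).prodMk measurable_snd.snd))
  rw [integrable_prod_iff hm.aestronglyMeasurable]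
  refine ⟨ae_of_all _ fun ω =>
    (integrable_signedIndicator (X ω)).mul_prod (integrable_signedIndicator (Y ω)), ?_⟩
  have h (ω : Ω) : ∫ z : ℝ × ℝ, ‖signedIndicator (X ω) z.1 * signedIndicator (Y ω) z.2‖
      ∂(volume.prod volume) = |X ω * Y ω| := by
    simp only [norm_mul, abs_mul]
    rw [integral_prod_mul (fun u => ‖signedIndicator (X ω) u‖)
      (fun v => ‖signedIndicator (Y ω) v‖),
      integral_norm_signedIndicator, integral_norm_signedIndicator]
  simpa only [h] using hXY.abs

lemma Hpair_eq_integral_signedIndicator [IsProbabilityMeasure μ]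
    (hX : Measurable X) (hY : Measurable Y) (u v : ℝ) :
    Hpair μ X Y u v = ∫ ω, signedIndicator (X ω) u * signedIndicator (Y ω) v ∂μ
      - (∫ ω, signedIndicator (X ω) u ∂μ) * ∫ ω, signedIndicator (Y ω) v ∂μ := by
  have hA : MeasurableSet {ω | u < X ω} := measurableSet_lt measurable_const hX
  have hB : MeasurableSet {ω | v < Y ω} := measurableSet_lt measurable_const hY
  set a : ℝ := if u < 0 then 1 else 0 with ha
  set b : ℝ := if v < 0 then 1 else 0 with hb
  set f : Ω → ℝ := {ω | u < X ω}.indicator 1 with hf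
  set g : Ω → ℝ := {ω | v < Y ω}.indicator 1 with hg
  have hfi : Integrable f μ := (integrable_const (1 : ℝ)).indicator hA
  have hgi : Integrable g μ := (integrable_const (1 : ℝ)).indicator hB
  have hfg : (fun ω => f ω * g ω) = {ω | u < X ω ∧ v < Y ω}.indicator 1 := by
    funext ω
    simp only [hf, hg, Set.indicator_apply, Set.mem_ofPred_eq, Pi.one_apply]
    grind
  have hfgi : Integrable (fun ω => f ω * g ω) μ := by
    rw [hfg]
    exact (integrable_const (1 : ℝ)).indicator (hA.inter hB)
  have hXf (ω : Ω) : signedIndicator (X ω) u = f ω - a := by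
    simp [signedIndicator, hf, ha, Set.indicator_apply]
  have hYg (ω : Ω) : signedIndicator (Y ω) v = g ω - b := by
    simp [signedIndicator, hg, hb, Set.indicator_apply]
  have h₁ : (μ {ω | u < X ω}).toReal = ∫ ω, f ω ∂μ := (integral_indicator_one hA).symm
  have h₂ : (μ {ω | v < Y ω}).toReal = ∫ ω, g ω ∂μ := (integral_indicator_one hB).symm
  have h₃ : (μ {ω | u < X ω ∧ v < Y ω}).toReal = ∫ ω, f ω * g ω ∂μ := by
    rw [hfg]
    exact (integral_indicator_one (hA.inter hB)).symm
  have h₄ : ∫ ω, (f ω - a) * (g ω - b) ∂μ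
      = ∫ ω, f ω * g ω ∂μ - b * ∫ ω, f ω ∂μ - a * ∫ ω, g ω ∂μ + a * b := by
    have e : (fun ω => (f ω - a) * (g ω - b))
        = fun ω => f ω * g ω - b * f ω - a * g ω + a * b := by
      funext ω
      ring
    have h₅ : Integrable (fun ω => f ω * g ω - b * f ω) μ := hfgi.sub (hfi.const_mul b)
    have h₆ : Integrable (fun ω => f ω * g ω - b * f ω - a * g ω) μ :=
      h₅.sub (hgi.const_mul a)
    rw [e, integral_add h₆ (integrable_const _), integral_sub h₅ (hgi.const_mul a),
      integral_sub hfgi (hfi.const_mul b), integral_const_mul, integral_const_mul]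
    simp
  simp only [Hpair, hXf, hYg]
  rw [h₁, h₂, h₃, h₄, integral_sub hfi (integrable_const _),
    integral_sub hgi (integrable_const _)]
  simp
  ring

/-- **Hoeffding's covariance identity**. -/
theorem integral_integral_Hpair [IsProbabilityMeasure μ]
    (hX : Measurable X) (hY : Measurable Y) (hXi : Integrable X μ) (hYi : Integrable Y μ)
    (hXY : Integrable (fun ω => X ω * Y ω) μ) :
    ∫ u : ℝ, ∫ v : ℝ, Hpair μ X Y u v
      = ∫ ω, X ω * Y ω ∂μ - (∫ ω, X ω ∂μ) * ∫ ω, Y ω ∂μ := by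
  have hmean {Z : Ω → ℝ} (hZ : Measurable Z) (hZi : Integrable Z μ) :
      ∫ u : ℝ, ∫ ω, signedIndicator (Z ω) u ∂μ = ∫ ω, Z ω ∂μ := by
    rw [← integral_integral_swap (integrable_signedIndicator_prod hZ hZi)]
    simp only [integral_signedIndicator]
  have hI := integrable_signedIndicator_mul_prod hX hY hXY
  have hP := (integrable_signedIndicator_prod hX hXi).integral_prod_right.mul_prod
    (integrable_signedIndicator_prod hY hYi).integral_prod_right
  have hswap : ∫ z : ℝ × ℝ, ∫ ω, signedIndicator (X ω) z.1 * signedIndicator (Y ω) z.2 ∂μ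
      ∂(volume.prod volume) = ∫ ω, X ω * Y ω ∂μ := by
    rw [← integral_integral_swap hI]
    refine integral_congr_ae (ae_of_all _ fun ω => ?_)
    simp only
    rw [integral_prod_mul, integral_signedIndicator, integral_signedIndicator]
  simp only [Hpair_eq_integral_signedIndicator hX hY]
  rw [integral_integral (hI.integral_prod_right.sub hP),
    integral_sub hI.integral_prod_right hP, hswap,
    integral_prod_mul (fun u => ∫ ω, signedIndicator (X ω) u ∂μ)
      (fun v => ∫ ω, signedIndicator (Y ω) v ∂μ), hmean hX hXi, hmean hY hYi]

end

/-- If `H ≥ 0` everywhere (positive dependence), then `η = cov(X_0, X_k)`. -/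
theorem eta_eq_cov_of_posDep {Ω : Type*} [MeasurableSpace Ω]
    (μ : Measure Ω) [IsProbabilityMeasure μ]
    (X₀ Xk : Ω → ℝ) (hX₀ : Measurable X₀) (hXk : Measurable Xk)
    (hsq₀ : Integrable (fun ω => X₀ ω ^ 2) μ) (hsqk : Integrable (fun ω => Xk ω ^ 2) μ)
    (hpos : ∀ u v : ℝ, 0 ≤ Hpair μ X₀ Xk u v) :
    etaPair μ X₀ Xk
      = ∫ ω, X₀ ω * Xk ω ∂μ - (∫ ω, X₀ ω ∂μ) * (∫ ω, Xk ω ∂μ) := by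
  have h₀ : MemLp X₀ 2 μ := (memLp_two_iff_integrable_sq hX₀.aestronglyMeasurable).2 hsq₀
  have hk : MemLp Xk 2 μ := (memLp_two_iff_integrable_sq hXk.aestronglyMeasurable).2 hsqk
  simp only [etaPair, abs_of_nonneg (hpos _ _)]
  exact integral_integral_Hpair hX₀ hXk (h₀.integrable one_le_two) (hk.integrable one_le_two)
    (h₀.integrable_mul hk)
end
end
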